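/- arXiv:1101.5836 — 3 statements merged into one kernel-verified Lean document; each statement's English description precedes it below -/
import Mathlib

section
/- Let S₀ : ℝ → ℝ be three times continuously differentiable with S₀''(x₀) ≥ 0 for every x₀, and let φ⁰ : ℝ → ℝ be continuously differentiable. For (x,t) ∈ ℝ × [0,∞) let X(x,t) be the unique real number with X(x,t) + 2t·S₀'(X(x,t)) = x, let J(x,t) = 1 + 2t·S₀''(X(x,t)) > 0 be the Jacobian of the characteristic map, and let S(x,t) = S₀(X(x,t)) + t·(S₀'(X(x,t)))². Define φ(x,t) = φ⁰(X(x,t))·J(x,t)^{−1/2}. Then φ is continuously differentiable, φ(x,0) = φ⁰(x), and φ satisfies the transport equation ∂φ/∂t + 2·(∂S/∂x)·(∂φ/∂x) + (∂²S/∂x²)·φ = 0 on ℝ × (0,∞). Thus the amplitude of the WKB solution is given globally in time by φ = φ⁰/√J along the projected characteristics. -/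
open Set

open scoped Topology

/-- For fixed `t ≥ 0` the characteristic map of a nondecreasing velocity `g` is injective. -/
lemma characteristic_injective {g : ℝ → ℝ} (hg : Monotone g) {t : ℝ} (ht : 0 ≤ t) :
    Function.Injective fun y => y + 2 * t * g y :=
  (strictMono_id.add_monotone (hg.const_mul (by positivity : (0 : ℝ) ≤ 2 * t))).injective

/-- The foot of the characteristic through `(x, t)` depends on `(x, t)` as smoothly as the
nondecreasing velocity `g` allows. -/
lemma contDiffAt_characteristic_foot {g : ℝ → ℝ} {n : WithTop ℕ∞} (hg : ContDiff ℝ n g)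
    (hn : n ≠ 0) (hmono : Monotone g) {X : ℝ → ℝ → ℝ}
    (hX : ∀ x t : ℝ, 0 ≤ t → X x t + 2 * t * g (X x t) = x) {x t : ℝ} (ht : 0 < t) :
    ContDiffAt ℝ n (fun p : ℝ × ℝ => X p.1 p.2) (x, t) := by
  set f : (ℝ × ℝ) × ℝ → ℝ := fun q => q.2 + 2 * q.1.2 * g q.2 - q.1.1 with hf
  set u : (ℝ × ℝ) × ℝ := ((x, t), X x t) with hu
  have hfc : ContDiff ℝ n f := by fun_prop
  set c : ℝ := 1 + 2 * t * deriv g (X x t) with hc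
  have hc0 : 0 < c := by
    have := hmono.deriv_nonneg (x := X x t)
    positivity
  have hslice : HasDerivAt (fun y => f ((x, t), y)) c (X x t) := by
    have h := ((hg.differentiable hn).differentiableAt (x := X x t)).hasDerivAt
    exact ((hasDerivAt_id (X x t)).add (h.const_mul (2 * t))).sub_const x
  have hfd : fderiv ℝ f u (0, 1) = c :=
    (((hfc.differentiable hn).differentiableAt (x := u)).hasFDerivAt.comp_hasDerivAt (X x t)
      ((hasDerivAt_const (X x t) (x, t)).prodMk (hasDerivAt_id (X x t)))).unique hslice
  have hinv : (fderiv ℝ f u ∘L .inr ℝ (ℝ × ℝ) ℝ).IsInvertible :=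
    ⟨ContinuousLinearEquiv.unitsEquivAut ℝ (Units.mk0 c hc0.ne'), by ext; simp [hfd]⟩
  have hfu : f u = 0 := by simp [hf, hu, hX x t ht.le]
  have hcd : ContDiffAt ℝ n f u := hfc.contDiffAt
  refine (hcd.contDiffAt_implicitFunction hn hinv).congr_of_eventuallyEq ?_
  have hpos : ∀ᶠ p : ℝ × ℝ in 𝓝 u.1, 0 < p.2 :=
    continuous_snd.continuousAt.eventually (lt_mem_nhds ht)
  filter_upwards [hcd.eventually_apply_implicitFunction hn hinv, hpos] with p hp hp0
  rw [hfu] at hp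
  refine characteristic_injective hmono hp0.le ?_
  simp only [hX p.1 p.2 hp0.le]
  simp only [hf] at hp
  linarith

/-- The space derivative of the foot of the characteristic is the inverse Jacobian. -/
lemma hasDerivAt_characteristic_foot_space {g : ℝ → ℝ} (hg : ContDiff ℝ 1 g)
    (hmono : Monotone g) {X : ℝ → ℝ → ℝ}
    (hX : ∀ x t : ℝ, 0 ≤ t → X x t + 2 * t * g (X x t) = x) {x t : ℝ} (ht : 0 < t) :
    HasDerivAt (fun y => X y t) (1 / (1 + 2 * t * deriv g (X x t))) x := by
  have hXd := (contDiffAt_characteristic_foot hg one_ne_zero hmono hX (x := x) ht).differentiableAt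
    one_ne_zero
  have h : HasDerivAt (fun y => X y t) (deriv (fun y => X y t) x) x :=
    (hXd.comp x (f := fun y => (y, t)) (by fun_prop)).hasDerivAt
  have hgd := ((hg.differentiable one_ne_zero).differentiableAt (x := X x t)).hasDerivAt
  have h1 := h.add ((hgd.comp x h).const_mul (2 * t))
  have h2 : HasDerivAt (fun y => y) _ x :=
    h1.congr_of_eventuallyEq (.of_forall fun y => (hX y t ht.le).symm)
  have h3 := h2.unique (hasDerivAt_id x)
  have hc : 0 < 1 + 2 * t * deriv g (X x t) := by
    have := hmono.deriv_nonneg (x := X x t)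
    positivity
  convert h using 1
  rw [div_eq_iff hc.ne']
  linarith

/-- The foot of the characteristic is transported along the characteristics. -/
lemma hasDerivAt_characteristic_foot_time {g : ℝ → ℝ} (hg : ContDiff ℝ 1 g)
    (hmono : Monotone g) {X : ℝ → ℝ → ℝ}
    (hX : ∀ x t : ℝ, 0 ≤ t → X x t + 2 * t * g (X x t) = x) {x t : ℝ} (ht : 0 < t) :
    HasDerivAt (fun s => X x s)
      (-(2 * g (X x t)) * (1 / (1 + 2 * t * deriv g (X x t)))) t := by
  have hXd := (contDiffAt_characteristic_foot hg one_ne_zero hmono hX (x := x) ht).differentiableAt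
    one_ne_zero
  have h : HasDerivAt (fun s => X x s) (deriv (fun s => X x s) t) t :=
    (hXd.comp t (f := fun s => (x, s)) (by fun_prop)).hasDerivAt
  have hgd := ((hg.differentiable one_ne_zero).differentiableAt (x := X x t)).hasDerivAt
  have h1 := h.add (((hasDerivAt_id t).const_mul 2).mul (hgd.comp t h))
  have hconst : (fun _ => x) =ᶠ[𝓝 t] (fun s => X x s) + (fun s => 2 * id s) * g ∘ X x := by
    filter_upwards [lt_mem_nhds ht] with s hs using (hX x s hs.le).symm
  have h3 := (h1.congr_of_eventuallyEq hconst).unique (hasDerivAt_const t x)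
  simp only [id_eq, Function.comp_apply] at h3
  have hc : 0 < 1 + 2 * t * deriv g (X x t) := by
    have := hmono.deriv_nonneg (x := X x t)
    positivity
  convert h using 1
  rw [mul_one_div, div_eq_iff hc.ne']
  linarith

/-- The solution given by characteristics has space derivative constant along them. -/
lemma hasDerivAt_characteristic_solution {S₀ : ℝ → ℝ} (hS₀ : ContDiff ℝ 2 S₀)
    (hmono : Monotone (deriv S₀)) {X : ℝ → ℝ → ℝ}
    (hX : ∀ x t : ℝ, 0 ≤ t → X x t + 2 * t * deriv S₀ (X x t) = x) {x t : ℝ} (ht : 0 < t) :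
    HasDerivAt (fun y => S₀ (X y t) + t * (deriv S₀ (X y t)) ^ 2) (deriv S₀ (X x t)) x := by
  have hg : ContDiff ℝ 1 (deriv S₀) := ContDiff.deriv' (n := 1) hS₀
  have hXx := hasDerivAt_characteristic_foot_space hg hmono hX (x := x) ht
  have hS := ((hS₀.differentiable two_ne_zero).differentiableAt (x := X x t)).hasDerivAt
  have hgd := ((hg.differentiable one_ne_zero).differentiableAt (x := X x t)).hasDerivAt
  have hc : 0 < 1 + 2 * t * deriv (deriv S₀) (X x t) := by
    have := hmono.deriv_nonneg (x := X x t)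
    positivity
  refine ((hS.comp x hXx).add (((hgd.comp x hXx).pow 2).const_mul t)).congr_deriv ?_
  simp only [Function.comp_apply]
  field_simp
  ring

/-- Differentiating `F / √j` along a curve. -/
lemma HasDerivAt.div_sqrt {F j : ℝ → ℝ} {F' j' s : ℝ} (hF : HasDerivAt F F' s)
    (hj : HasDerivAt j j' s) (h0 : 0 < j s) :
    HasDerivAt (fun r => F r / √(j r)) (F' / √(j s) - F s * j' / (2 * j s * √(j s))) s := by
  refine (hF.div (hj.sqrt h0.ne') (Real.sqrt_pos.2 h0).ne').congr_deriv ?_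
  have h1 := Real.sqrt_pos.2 h0
  have h2 := Real.sq_sqrt h0.le
  field_simp
  rw [h2]
  ring

/-- For `S₀ ∈ C³(ℝ)` with `S₀'' ≥ 0` and `φ0 ∈ C¹(ℝ)`, let `X x t` solve
`X + 2 t S₀'(X) = x`, let `J x t = 1 + 2 t S₀''(X x t) > 0` be the Jacobian of the
characteristic map, let `S x t = S₀(X x t) + t (S₀'(X x t))²`, and define
`φ x t = φ0(X x t) · (J x t)^{-1/2}`.  Then `φ` is continuously differentiable,
`φ x 0 = φ0 x`, and `φ` satisfies the transport equation
`∂φ/∂t + 2 (∂S/∂x) (∂φ/∂x) + (∂²S/∂x²) φ = 0` on `ℝ × (0,∞)`: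
the WKB amplitude is given globally in time by `φ = φ0/√J` along projected characteristics. -/
theorem wkb_amplitude_global_formula
    (S₀ : ℝ → ℝ) (hS₀ : ContDiff ℝ 3 S₀)
    (hconv : ∀ x₀ : ℝ, 0 ≤ deriv (deriv S₀) x₀)
    (φ0 : ℝ → ℝ) (hφ0 : ContDiff ℝ 1 φ0)
    (X : ℝ → ℝ → ℝ)
    (hX : ∀ x t : ℝ, 0 ≤ t → X x t + 2 * t * deriv S₀ (X x t) = x)
    (J : ℝ → ℝ → ℝ)
    (hJdef : ∀ x t : ℝ, J x t = 1 + 2 * t * deriv (deriv S₀) (X x t))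
    (hJpos : ∀ x t : ℝ, 0 ≤ t → 0 < J x t)
    (S : ℝ → ℝ → ℝ)
    (hSdef : ∀ x t : ℝ, S x t = S₀ (X x t) + t * (deriv S₀ (X x t)) ^ 2)
    (φ : ℝ → ℝ → ℝ)
    (hφdef : ∀ x t : ℝ, φ x t = φ0 (X x t) / Real.sqrt (J x t)) :
    ContDiffOn ℝ 1 (fun p : ℝ × ℝ => φ p.1 p.2) (univ ×ˢ Ioi (0 : ℝ)) ∧
    (∀ x : ℝ, φ x 0 = φ0 x) ∧
    (∀ x t : ℝ, 0 < t →
      deriv (fun s => φ x s) t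
        + 2 * deriv (fun y => S y t) x * deriv (fun y => φ y t) x
        + deriv (fun y => deriv (fun z => S z t) y) x * φ x t = 0) := by
  have hg : ContDiff ℝ 2 (deriv S₀) := ContDiff.deriv' (n := 2) hS₀
  have hg1 : ContDiff ℝ 1 (deriv S₀) := hg.of_le one_le_two
  have hk : ContDiff ℝ 1 (deriv (deriv S₀)) := ContDiff.deriv' (n := 1) hg
  have hmono : Monotone (deriv S₀) :=
    monotone_of_deriv_nonneg (hg.differentiable two_ne_zero) hconv
  obtain rfl : J = fun x t => 1 + 2 * t * deriv (deriv S₀) (X x t) := by ext; apply hJdef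
  obtain rfl : S = fun x t => S₀ (X x t) + t * (deriv S₀ (X x t)) ^ 2 := by ext; apply hSdef
  obtain rfl : φ = fun x t => φ0 (X x t) / √(1 + 2 * t * deriv (deriv S₀) (X x t)) := by
    ext; apply hφdef
  refine ⟨?_, fun x => ?_, fun x t ht => ?_⟩
  · rintro ⟨x, t⟩ ⟨-, ht : 0 < t⟩
    have hXc := contDiffAt_characteristic_foot hg1 one_ne_zero hmono hX (x := x) ht
    have hJc : ContDiffAt ℝ 1
        (fun p : ℝ × ℝ => 1 + 2 * p.2 * deriv (deriv S₀) (X p.1 p.2)) (x, t) :=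
      contDiffAt_const.add ((contDiffAt_const.mul contDiffAt_snd).mul
        (hk.contDiffAt.comp (x, t) hXc))
    have hJ0 := hJpos x t ht.le
    exact ((hφ0.contDiffAt.comp (x, t) hXc).div (hJc.sqrt hJ0.ne')
      (Real.sqrt_pos.2 hJ0).ne').contDiffWithinAt
  · have h0 : X x 0 = x := by simpa using hX x 0 le_rfl
    simp [h0]
  · have hXx := hasDerivAt_characteristic_foot_space hg1 hmono hX (x := x) ht
    have hXt := hasDerivAt_characteristic_foot_time hg1 hmono hX (x := x) ht
    have hJ0 : 0 < 1 + 2 * t * deriv (deriv S₀) (X x t) := hJpos x t ht.le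
    have hφd := ((hφ0.differentiable one_ne_zero).differentiableAt (x := X x t)).hasDerivAt
    have hgd := ((hg1.differentiable one_ne_zero).differentiableAt (x := X x t)).hasDerivAt
    have hkd := ((hk.differentiable one_ne_zero).differentiableAt (x := X x t)).hasDerivAt
    have hSx : (fun y => deriv (fun z => S₀ (X z t) + t * (deriv S₀ (X z t)) ^ 2) y)
        = fun y => deriv S₀ (X y t) := funext fun y =>
      (hasDerivAt_characteristic_solution (hS₀.of_le (by norm_num)) hmono hX ht).deriv
    have hSxx := (hgd.comp x hXx).deriv
    have hφx := ((hφd.comp x hXx).div_sqrt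
      (((hkd.comp x hXx).const_mul (2 * t)).const_add 1) hJ0).deriv
    have hφt := ((hφd.comp t hXt).div_sqrt
      ((((hasDerivAt_id t).const_mul 2).mul (hkd.comp t hXt)).const_add 1) hJ0).deriv
    simp only [Function.comp_def, id_eq, Pi.mul_apply] at hSxx hφx hφt
    rw [hSx, congrFun hSx x, hSxx, hφx, hφt]
    beta_reduce
    have hsq := Real.sqrt_pos.2 hJ0
    set k := deriv (deriv S₀) (X x t)
    set r := √(1 + 2 * t * k)
    field_simp
    ring
end

section
/- Let ρ : ℝ → ℝ be a bounded measurable function with ρ(x) ≥ 0 for all x, let e ≥ 0 and x* ∈ ℝ, and let ω : ℝ → ℝ be a measurable function with 0 ≤ ω(η) ≤ C·(1+η²)^{−2} for all η and some constant C (for instance, a nonnegative Schwartz function). Then for every bounded measurable compactly supported test function φ : ℝ → ℝ, lim_{ε→0⁺} ∫_ℝ [ √(ρ(x) + (e/ε)·ω((x − x*)/ε)) − √(ρ(x)) ]·φ(x) dx = 0. In other words, the weak limit of √(ρ_reg + e·δ_ε) coincides with √(ρ_reg), where δ_ε(x) = ε^{−1}ω((x−x*)/ε) is a regularization of the Dirac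 delta at x*. -/
open Set Filter

/-- Pointwise bound for the increment of the square root under a perturbation of mass `e`
concentrated at scale `ε`, whose profile `w` satisfies `w ≤ C (1 + η²)⁻²`. -/
theorem abs_sqrt_add_sub_sqrt_le {a e ε C w η : ℝ} (ha : 0 ≤ a) (he : 0 ≤ e) (hε : 0 < ε)
    (hw0 : 0 ≤ w) (hw : w ≤ C * (1 + η ^ 2)⁻¹ ^ 2) :
    |Real.sqrt (a + e / ε * w) - Real.sqrt a| ≤ Real.sqrt (e * C / ε) * (1 + η ^ 2)⁻¹ := by
  have hb : 0 ≤ e / ε * w := by positivity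
  rw [abs_of_nonneg (sub_nonneg.2 (Real.sqrt_le_sqrt (by linarith)))]
  calc Real.sqrt (a + e / ε * w) - Real.sqrt a ≤ Real.sqrt (e / ε * w) := by
        rw [sub_le_iff_le_add', Real.sqrt_le_left (by positivity)]
        nlinarith [Real.sq_sqrt ha, Real.sq_sqrt hb,
          mul_nonneg (Real.sqrt_nonneg a) (Real.sqrt_nonneg (e / ε * w))]
    _ ≤ Real.sqrt (e * C / ε * (1 + η ^ 2)⁻¹ ^ 2) := by
        apply Real.sqrt_le_sqrt
        calc e / ε * w ≤ e / ε * (C * (1 + η ^ 2)⁻¹ ^ 2) := by gcongr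
          _ = e * C / ε * (1 + η ^ 2)⁻¹ ^ 2 := by ring
    _ = Real.sqrt (e * C / ε) * (1 + η ^ 2)⁻¹ := by
        rw [Real.sqrt_mul' _ (by positivity), Real.sqrt_sq (by positivity)]

theorem integrable_inv_one_add_sq_comp_sub_div {ε : ℝ} (hε : ε ≠ 0) (c : ℝ) :
    MeasureTheory.Integrable fun x : ℝ => (1 + ((x - c) / ε) ^ 2)⁻¹ :=
  (integrable_inv_one_add_sq.comp_div hε).comp_sub_right c

theorem integral_inv_one_add_sq_comp_sub_div {ε : ℝ} (hε : 0 < ε) (c : ℝ) :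
    ∫ x : ℝ, (1 + ((x - c) / ε) ^ 2)⁻¹ = ε * Real.pi := by
  rw [MeasureTheory.integral_sub_right_eq_self (fun x : ℝ => (1 + (x / ε) ^ 2)⁻¹) c,
    MeasureTheory.Measure.integral_comp_div (fun x : ℝ => (1 + x ^ 2)⁻¹) ε,
    integral_univ_inv_one_add_sq, abs_of_pos hε, smul_eq_mul]

/-- Let `ρ : ℝ → ℝ` be bounded, measurable, nonnegative, let `e ≥ 0`, `x* ∈ ℝ`,
and let `ω` be measurable with `0 ≤ ω η ≤ C (1 + η²)⁻²`.  Then for every bounded measurable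
compactly supported test function `φ`,
`∫ (√(ρ(x) + (e/ε) ω((x−x*)/ε)) − √(ρ(x))) φ(x) dx → 0` as `ε → 0⁺`:
the weak limit of `√(ρ_reg + e δ_ε)` coincides with `√(ρ_reg)`, where
`δ_ε(x) = ε⁻¹ ω((x−x*)/ε)` regularizes the Dirac delta at `x*`. -/
theorem sqrt_of_delta_regularization_weak_limit
    (ρ : ℝ → ℝ) (hρmeas : Measurable ρ)
    (M : ℝ) (hρbdd : ∀ x : ℝ, ρ x ≤ M)
    (hρnonneg : ∀ x : ℝ, 0 ≤ ρ x)
    (e : ℝ) (he : 0 ≤ e) (xstar : ℝ)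
    (ω : ℝ → ℝ) (hωmeas : Measurable ω)
    (C : ℝ) (hω : ∀ η : ℝ, 0 ≤ ω η ∧ ω η ≤ C * (1 + η ^ 2)⁻¹ ^ 2)
    (φ : ℝ → ℝ) (hφmeas : Measurable φ)
    (K : ℝ) (hφbdd : ∀ x : ℝ, |φ x| ≤ K)
    (hφsupp : HasCompactSupport φ) :
    Tendsto
      (fun ε : ℝ => ∫ x : ℝ,
        (Real.sqrt (ρ x + (e / ε) * ω ((x - xstar) / ε)) - Real.sqrt (ρ x)) * φ x)
      (nhdsWithin 0 (Ioi 0)) (nhds 0) := by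
  have hK : 0 ≤ K := (abs_nonneg _).trans (hφbdd 0)
  have hlim : Tendsto (fun ε : ℝ => K * Real.pi * Real.sqrt (e * C * ε))
      (nhdsWithin 0 (Ioi 0)) (nhds 0) := by
    have hc : Continuous fun ε : ℝ => K * Real.pi * Real.sqrt (e * C * ε) := by fun_prop
    simpa using (hc.tendsto 0).mono_left nhdsWithin_le_nhds
  refine squeeze_zero_norm' ?_ hlim
  filter_upwards [self_mem_nhdsWithin] with ε (hε : 0 < ε)
  have hint := integrable_inv_one_add_sq_comp_sub_div hε.ne' xstar
  refine (MeasureTheory.norm_integral_le_of_norm_le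
    (hint.const_mul (K * Real.sqrt (e * C / ε))) (.of_forall fun x => ?_)).trans_eq ?_
  · rw [norm_mul, Real.norm_eq_abs, Real.norm_eq_abs, mul_comm, mul_assoc]
    exact mul_le_mul (hφbdd x)
      (abs_sqrt_add_sub_sqrt_le (hρnonneg x) he hε (hω _).1 (hω _).2) (abs_nonneg _) hK
  · rw [MeasureTheory.integral_const_mul, integral_inv_one_add_sq_comp_sub_div hε]
    have hsqrt : Real.sqrt (e * C * ε) = Real.sqrt (e * C / ε) * ε := by
      rw [show e * C * ε = e * C / ε * ε ^ 2 by field_simp,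
        Real.sqrt_mul' _ (sq_nonneg ε), Real.sqrt_sq hε.le]
    rw [hsqrt]
    ring
end

section
/- Let ψ : ℝ → ℝ be twice continuously differentiable with ψ(x) > 0 and ψ'(x) > 0 for all x; let e : ℝ → ℝ be continuously differentiable with compact support; and let R₀, R₁, u₀, u₁ : ℝ × [0,∞) → ℝ be continuously differentiable. Define R(x,t) = R₀(x,t) + H(t − ψ(x))·R₁(x,t) and u(x,t) = u₀(x,t) + H(t − ψ(x))·u₁(x,t), where H is the Heaviside function (H(s) = 1 for s > 0, H(s) = 0 for s ≤ 0). Then the following two assertions are equivalent. (1) For every smooth compactly supported test function ζ : ℝ × (0,∞) → ℝ, ∫₀^∞∫_ℝ [ R·∂ζ/∂t + u·R·∂ζ/∂x ] dx dt + ∫_ℝ [ (e(x)/ψ'(x))·∂ζ/∂x(x, ψ(x)) + e(x)·∂ζ/∂t(x, ψ(x)) ] dx = 0. (2) Both: (i) ∂R₀/∂t + ∂(u₀R₀)/∂x = 0 at every (x,t) with 0 < t < ψ(x), and ∂(R₀+R₁)/∂t + ∂((u₀+u₁)(R₀+R₁))/∂x = 0 at every (x,t) with t > ψ(x); and (ii)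 the Rankine–Hugoniot-type relation d/dx [ e(x)/ψ'(x) ] = ψ'(x)·[ (u₀+u₁)(R₀+R₁) − u₀R₀ ](x, ψ(x)) − R₁(x, ψ(x)) holds for every x ∈ ℝ. -/
open Set MeasureTheory

/-- The shear `(x, s) ↦ (x, s + ψ x)` of the plane. -/
def verticalShear (ψ : ℝ → ℝ) (hψ : Continuous ψ) : ℝ × ℝ ≃ₜ ℝ × ℝ where
  toFun p := (p.1, p.2 + ψ p.1)
  invFun p := (p.1, p.2 - ψ p.1)
  left_inv p := by simp
  right_inv p := by simp
  continuous_toFun := by fun_prop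
  continuous_invFun := by fun_prop

lemma measurePreserving_verticalShear (ψ : ℝ → ℝ) (hψ : Continuous ψ) :
    MeasurePreserving (verticalShear ψ hψ) volume volume :=
  (MeasurePreserving.id volume).skew_product (g := fun x s => s + ψ x)
    (by have := hψ.measurable; fun_prop)
    (Filter.Eventually.of_forall fun x => map_add_right_eq_self volume (ψ x))

lemma hasDerivAt_vertical {F : ℝ × ℝ → ℝ} {x t : ℝ} (hF : DifferentiableAt ℝ F (x, t)) :
    HasDerivAt (fun s => F (x, s)) (fderiv ℝ F (x, t) (0, 1)) t :=
  hF.hasFDerivAt.comp_hasDerivAt t ((hasDerivAt_const t x).prodMk (hasDerivAt_id t))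

lemma hasDerivAt_horizontal {F : ℝ × ℝ → ℝ} {x t : ℝ} (hF : DifferentiableAt ℝ F (x, t)) :
    HasDerivAt (fun y => F (y, t)) (fderiv ℝ F (x, t) (1, 0)) x :=
  hF.hasFDerivAt.comp_hasDerivAt (f := fun y => (y, t)) x
    ((hasDerivAt_id x).prodMk (hasDerivAt_const x t))

lemma hasDerivAt_along_graph {F : ℝ × ℝ → ℝ} {ψ : ℝ → ℝ} {x s : ℝ}
    (hF : DifferentiableAt ℝ F (x, s + ψ x)) (hψ : DifferentiableAt ℝ ψ x) :
    HasDerivAt (fun y => F (y, s + ψ y))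
      (fderiv ℝ F (x, s + ψ x) (1, 0) + deriv ψ x * fderiv ℝ F (x, s + ψ x) (0, 1)) x := by
  have h := hF.hasFDerivAt.comp_hasDerivAt (f := fun y => (y, s + ψ y)) x
    ((hasDerivAt_id x).prodMk (hψ.hasDerivAt.const_add s))
  have e : ((1 : ℝ), deriv ψ x) = (1, 0) + deriv ψ x • ((0 : ℝ), (1 : ℝ)) := by simp
  rw [e, map_add, map_smul, smul_eq_mul] at h
  exact h

lemma HasCompactSupport.comp_vertical {F : ℝ × ℝ → ℝ} (hF : HasCompactSupport F) (x c : ℝ) :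
    HasCompactSupport fun s => F (x, s + c) :=
  hF.comp_isClosedEmbedding (g := fun s => (x, s + c)) <|
    Function.LeftInverse.isClosedEmbedding (f := fun p : ℝ × ℝ => p.2 - c) (fun s => by simp)
      (by fun_prop) (by fun_prop)

lemma HasCompactSupport.comp_graph {F : ℝ × ℝ → ℝ} (hF : HasCompactSupport F) {g : ℝ → ℝ}
    (hg : Continuous g) : HasCompactSupport fun x => F (x, g x) :=
  hF.comp_isClosedEmbedding (g := fun x => (x, g x)) <|
    Function.LeftInverse.isClosedEmbedding (f := Prod.fst) (fun x => rfl)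
      continuous_fst (by fun_prop)

/-- The divergence theorem on the epigraph of a `C¹` function. -/
theorem integral_epigraph_divergence {A B : ℝ × ℝ → ℝ} {ψ : ℝ → ℝ}
    (hA : ContDiff ℝ 1 A) (hB : ContDiff ℝ 1 B) (hψ : ContDiff ℝ 1 ψ)
    (hAs : HasCompactSupport A) (hBs : HasCompactSupport B) :
    ∫ p in {p : ℝ × ℝ | ψ p.1 < p.2}, (fderiv ℝ A p (0, 1) + fderiv ℝ B p (1, 0))
      = ∫ x, (deriv ψ x * B (x, ψ x) - A (x, ψ x)) := by
  have hψc := hψ.continuous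
  have hψd : Differentiable ℝ ψ := hψ.differentiable one_ne_zero
  have hAd : Differentiable ℝ A := hA.differentiable one_ne_zero
  have hBd : Differentiable ℝ B := hB.differentiable one_ne_zero
  have hψ' : Continuous (deriv ψ) := hψ.continuous_deriv le_rfl
  have cA : ∀ v, Continuous fun p => fderiv ℝ A p v := fun v =>
    (hA.continuous_fderiv one_ne_zero).clm_apply continuous_const
  have cB : ∀ v, Continuous fun p => fderiv ℝ B p v := fun v =>
    (hB.continuous_fderiv one_ne_zero).clm_apply continuous_const
  set Φ := verticalShear ψ hψc with hΦ
  have hpre : Φ ⁻¹' {p : ℝ × ℝ | ψ p.1 < p.2} = univ ×ˢ Ioi 0 := by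
    ext p; simp [hΦ, verticalShear]
  set N : ℝ × ℝ → ℝ := fun p => fderiv ℝ A (Φ p) (0, 1) - deriv ψ p.1 * fderiv ℝ B (Φ p) (0, 1)
  set T : ℝ × ℝ → ℝ := fun p => fderiv ℝ B (Φ p) (1, 0) + deriv ψ p.1 * fderiv ℝ B (Φ p) (0, 1)
  have sA := ((hAs.fderiv_apply ℝ (0, 1)).comp_homeomorph Φ)
  have sB := ((hBs.fderiv_apply ℝ (0, 1)).comp_homeomorph Φ)
  have sB' := ((hBs.fderiv_apply ℝ (1, 0)).comp_homeomorph Φ)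
  have hNi : Integrable N := by
    refine Continuous.integrable_of_hasCompactSupport ?_ (sA.sub sB.mul_left)
    exact ((cA _).comp Φ.continuous).sub
      ((hψ'.comp continuous_fst).mul ((cB _).comp Φ.continuous))
  have hTi : Integrable T := by
    refine Continuous.integrable_of_hasCompactSupport ?_ (sB'.add sB.mul_left)
    exact ((cB _).comp Φ.continuous).add
      ((hψ'.comp continuous_fst).mul ((cB _).comp Φ.continuous))
  have hrestr : (volume : Measure (ℝ × ℝ)).restrict (univ ×ˢ Ioi 0)
      = (volume : Measure ℝ).prod (volume.restrict (Ioi 0)) := by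
    rw [Measure.volume_eq_prod, ← Measure.prod_restrict, Measure.restrict_univ]
  have hN : ∫ p in univ ×ˢ Ioi 0, N p = ∫ x, (deriv ψ x * B (x, ψ x) - A (x, ψ x)) := by
    have hi := hNi.integrableOn (s := univ ×ˢ Ioi 0)
    rw [IntegrableOn, hrestr] at hi
    rw [hrestr, integral_prod _ hi]
    refine integral_congr_ae (Filter.Eventually.of_forall fun x => ?_)
    have hd : ∀ s, HasDerivAt
        (fun s => A (x, s + ψ x) - deriv ψ x * B (x, s + ψ x)) (N (x, s)) s := fun s =>
      ((hasDerivAt_vertical (hAd _)).comp_add_const s (ψ x)).sub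
        (((hasDerivAt_vertical (hBd _)).comp_add_const s (ψ x)).const_mul (deriv ψ x))
    have := HasCompactSupport.integral_Ioi_deriv_eq
      (f := fun s => A (x, s + ψ x) - deriv ψ x * B (x, s + ψ x)) (by fun_prop)
      ((hAs.comp_vertical x (ψ x)).sub (hBs.comp_vertical x (ψ x)).mul_left) 0
    simp only [(hd _).deriv] at this
    simp only [this]
    ring_nf
  have hT : ∫ p in univ ×ˢ Ioi 0, T p = 0 := by
    have hi := hTi.integrableOn (s := univ ×ˢ Ioi 0)
    rw [IntegrableOn, hrestr] at hi
    rw [hrestr, integral_prod_symm _ hi]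
    refine integral_eq_zero_of_ae (Filter.Eventually.of_forall fun s => ?_)
    refine integral_eq_zero_of_hasDerivAt_of_integrable
      (fun x => hasDerivAt_along_graph (hBd _) (hψd x)) ?_ ?_
    · refine Continuous.integrable_of_hasCompactSupport (by fun_prop) ?_
      exact ((hBs.fderiv_apply ℝ (1, 0)).comp_graph (hψc.const_add s)).add
        ((hBs.fderiv_apply ℝ (0, 1)).comp_graph (hψc.const_add s)).mul_left
    · exact Continuous.integrable_of_hasCompactSupport (by fun_prop) (hBs.comp_graph (hψc.const_add s))
  have hsum : ∫ p in univ ×ˢ Ioi 0, (N p + T p) = ∫ x, (deriv ψ x * B (x, ψ x) - A (x, ψ x)) := by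
    rw [integral_add hNi.integrableOn hTi.integrableOn, hN, hT, add_zero]
  rw [← (measurePreserving_verticalShear ψ hψc).setIntegral_preimage_emb
    Φ.measurableEmbedding, hpre, ← hsum]
  refine integral_congr_ae (Filter.Eventually.of_forall fun p => ?_)
  simp only [N, T, hΦ]
  ring

lemma ContinuousOn.mul_of_tsupport_subset {X : Type*} [TopologicalSpace X] {F k : X → ℝ}
    {U : Set X} (hU : IsOpen U) (hF : ContinuousOn F U) (hk : Continuous k)
    (hs : tsupport k ⊆ U) : Continuous fun p => F p * k p :=
  continuous_of_tsupport fun _ hp =>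
    (hF.continuousAt (hU.mem_nhds (hs (tsupport_mul_subset_right hp)))).mul hk.continuousAt

lemma ContDiffOn.mul_of_tsupport_subset {E : Type*} [NormedAddCommGroup E] [NormedSpace ℝ E]
    {F k : E → ℝ} {U : Set E} {n : WithTop ℕ∞} (hU : IsOpen U) (hF : ContDiffOn ℝ n F U)
    (hk : ContDiff ℝ n k) (hs : tsupport k ⊆ U) : ContDiff ℝ n fun p => F p * k p := by
  refine contDiff_iff_contDiffAt.2 fun p => ?_
  by_cases hp : p ∈ tsupport k
  · exact (hF.contDiffAt (hU.mem_nhds (hs hp))).mul hk.contDiffAt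
  · refine (contDiffAt_const (c := (0 : ℝ))).congr_of_eventuallyEq ?_
    filter_upwards [notMem_tsupport_iff_eventuallyEq.1 hp] with q hq
    simp [hq]

lemma fderiv_mul_of_tsupport_subset {E : Type*} [NormedAddCommGroup E] [NormedSpace ℝ E]
    {F k : E → ℝ} {U : Set E} (hU : IsOpen U) (hF : DifferentiableOn ℝ F U)
    (hk : Differentiable ℝ k) (hs : tsupport k ⊆ U) (p v : E) :
    fderiv ℝ (fun q => F q * k q) p v = F p * fderiv ℝ k p v + fderiv ℝ F p v * k p := by
  by_cases hp : p ∈ tsupport k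
  · rw [fderiv_fun_mul (hF.differentiableAt (hU.mem_nhds (hs hp))) (hk p)]
    simp
    ring
  · have h0 := notMem_tsupport_iff_eventuallyEq.1 hp
    have h1 : (fun q => F q * k q) =ᶠ[nhds p] fun _ => 0 := by
      filter_upwards [h0] with q hq
      simp [hq]
    have h2 : k =ᶠ[nhds p] fun _ => 0 := h0
    rw [h1.fderiv_eq, h2.fderiv_eq, h0.self_of_nhds]
    simp

lemma integrable_mul_fderiv {A ζ : ℝ × ℝ → ℝ} {U : Set (ℝ × ℝ)} (hU : IsOpen U)
    (hA : ContinuousOn A U) (hζ : ContDiff ℝ 1 ζ) (hζc : HasCompactSupport ζ)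
    (hs : tsupport ζ ⊆ U) (v : ℝ × ℝ) : Integrable fun p => A p * fderiv ℝ ζ p v :=
  (hA.mul_of_tsupport_subset hU ((hζ.continuous_fderiv one_ne_zero).clm_apply continuous_const)
    ((tsupport_fderiv_apply_subset ℝ v).trans hs)).integrable_of_hasCompactSupport
    (hζc.fderiv_apply ℝ v).mul_left

lemma continuousOn_fderiv_apply {A : ℝ × ℝ → ℝ} {U : Set (ℝ × ℝ)} (hU : IsOpen U)
    (hA : ContDiffOn ℝ 1 A U) (v : ℝ × ℝ) : ContinuousOn (fun p => fderiv ℝ A p v) U :=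
  (hA.continuousOn_fderiv_of_isOpen hU le_rfl).clm_apply continuousOn_const

lemma integrable_fderiv_mul {A ζ : ℝ × ℝ → ℝ} {U : Set (ℝ × ℝ)} (hU : IsOpen U)
    (hA : ContDiffOn ℝ 1 A U) (hζ : Continuous ζ) (hζc : HasCompactSupport ζ)
    (hs : tsupport ζ ⊆ U) (v : ℝ × ℝ) : Integrable fun p => fderiv ℝ A p v * ζ p :=
  ((continuousOn_fderiv_apply hU hA v).mul_of_tsupport_subset hU hζ
    hs).integrable_of_hasCompactSupport hζc.mul_left

/-- Integration by parts on the epigraph of a `C¹` function against a compactly supported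
function. -/
theorem integral_epigraph_by_parts {A B ζ : ℝ × ℝ → ℝ} {ψ : ℝ → ℝ} {U : Set (ℝ × ℝ)}
    (hU : IsOpen U) (hA : ContDiffOn ℝ 1 A U) (hB : ContDiffOn ℝ 1 B U) (hψ : ContDiff ℝ 1 ψ)
    (hζ : ContDiff ℝ 1 ζ) (hζc : HasCompactSupport ζ) (hs : tsupport ζ ⊆ U) :
    ∫ p in {p : ℝ × ℝ | ψ p.1 < p.2}, (A p * fderiv ℝ ζ p (0, 1) + B p * fderiv ℝ ζ p (1, 0))
      = (∫ x, (deriv ψ x * B (x, ψ x) - A (x, ψ x)) * ζ (x, ψ x))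
        - ∫ p in {p : ℝ × ℝ | ψ p.1 < p.2},
            (fderiv ℝ A p (0, 1) + fderiv ℝ B p (1, 0)) * ζ p := by
  have hζd := hζ.differentiable one_ne_zero
  have key := integral_epigraph_divergence (hA.mul_of_tsupport_subset hU hζ hs)
    (hB.mul_of_tsupport_subset hU hζ hs) hψ hζc.mul_left hζc.mul_left
  simp only [fderiv_mul_of_tsupport_subset hU (hA.differentiableOn one_ne_zero) hζd hs,
    fderiv_mul_of_tsupport_subset hU (hB.differentiableOn one_ne_zero) hζd hs] at key
  have i1 := ((integrable_mul_fderiv hU hA.continuousOn hζ hζc hs (0, 1)).add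
    (integrable_mul_fderiv hU hB.continuousOn hζ hζc hs (1, 0))).integrableOn
      (s := {p : ℝ × ℝ | ψ p.1 < p.2})
  have i2 := ((integrable_fderiv_mul hU hA hζ.continuous hζc hs (0, 1)).add
    (integrable_fderiv_mul hU hB hζ.continuous hζc hs (1, 0))).integrableOn
      (s := {p : ℝ × ℝ | ψ p.1 < p.2})
  have hsum := integral_add i1 i2
  simp only [Pi.add_apply, ← add_mul] at hsum
  rw [eq_sub_iff_add_eq, ← hsum]
  convert key using 1
  · congr 1 with p
    ring
  · congr 1 with x
    ring

/-- A continuous function on an open set that is orthogonal to all test functions vanishes. -/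
lemma ContinuousOn.eq_zero_of_integral_test_mul_eq_zero {E : Type*} [NormedAddCommGroup E]
    [NormedSpace ℝ E] [FiniteDimensional ℝ E] [MeasurableSpace E] [BorelSpace E] {μ : Measure E}
    [μ.IsOpenPosMeasure] [IsLocallyFiniteMeasure μ] {f : E → ℝ} {U : Set E}
    (hf : ContinuousOn f U) (hU : IsOpen U)
    (h : ∀ g : E → ℝ, ContDiff ℝ (⊤ : ℕ∞) g → HasCompactSupport g → tsupport g ⊆ U →
      ∫ x, g x * f x ∂μ = 0) {x : E} (hx : x ∈ U) : f x = 0 :=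
  Measure.eqOn_open_of_ae_eq (μ := μ) ((ae_restrict_iff' hU.measurableSet).2
    (hU.ae_eq_zero_of_integral_contDiff_smul_eq_zero
      (hf.locallyIntegrableOn hU.measurableSet) h)) hU hf continuousOn_const hx

lemma integral_mul_deriv_along_graph {ζ : ℝ × ℝ → ℝ} {ψ g : ℝ → ℝ}
    (hg : ContDiff ℝ 1 g) (hψ : ContDiff ℝ 1 ψ) (hζ : ContDiff ℝ 1 ζ) (hζc : HasCompactSupport ζ) :
    ∫ x, g x * (fderiv ℝ ζ (x, ψ x) (1, 0) + deriv ψ x * fderiv ℝ ζ (x, ψ x) (0, 1))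
      = -∫ x, deriv g x * ζ (x, ψ x) := by
  have hψc := hψ.continuous
  have hgc := hg.continuous
  have hζ0 := hζ.continuous
  have hψ' : Continuous (deriv ψ) := hψ.continuous_deriv le_rfl
  have hg' : Continuous (deriv g) := hg.continuous_deriv le_rfl
  have c : ∀ v, Continuous fun p => fderiv ℝ ζ p v := fun v =>
    (hζ.continuous_fderiv one_ne_zero).clm_apply continuous_const
  have s := hζc.comp_graph hψc
  refine integral_mul_deriv_eq_deriv_mul_of_integrable
    (u := g) (v := fun x => ζ (x, ψ x)) (u' := deriv g)
    (v' := fun x => fderiv ℝ ζ (x, ψ x) (1, 0) + deriv ψ x * fderiv ℝ ζ (x, ψ x) (0, 1))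
    (fun x _ => (hg.differentiable one_ne_zero x).hasDerivAt) (fun x _ => ?_) ?_ ?_ ?_
  · simpa using hasDerivAt_along_graph (s := 0) (hζ.differentiable one_ne_zero _)
      (hψ.differentiable one_ne_zero x)
  · refine Continuous.integrable_of_hasCompactSupport ?_ (HasCompactSupport.mul_left ?_)
    · exact hgc.mul (by fun_prop)
    · exact ((hζc.fderiv_apply ℝ (1, 0)).comp_graph hψc).add
        ((hζc.fderiv_apply ℝ (0, 1)).comp_graph hψc).mul_left
  · exact (hg'.mul (by fun_prop)).integrable_of_hasCompactSupport s.mul_left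
  · exact (hgc.mul (by fun_prop)).integrable_of_hasCompactSupport s.mul_left

/-- Integration by parts for a density `r₀ + H r₁` and a flux `f₀ + H f₁`, where `H` is the
indicator of the epigraph of `ψ`. -/
theorem integral_jump_by_parts {r₀ f₀ r₁ f₁ ζ : ℝ × ℝ → ℝ} {ψ : ℝ → ℝ}
    (hr₀ : ContDiffOn ℝ 1 r₀ (univ ×ˢ Ioi 0)) (hf₀ : ContDiffOn ℝ 1 f₀ (univ ×ˢ Ioi 0))
    (hr₁ : ContDiffOn ℝ 1 r₁ (univ ×ˢ Ioi 0)) (hf₁ : ContDiffOn ℝ 1 f₁ (univ ×ˢ Ioi 0))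
    (hψ : ContDiff ℝ 1 ψ) (hζ : ContDiff ℝ 1 ζ) (hζc : HasCompactSupport ζ)
    (hs : tsupport ζ ⊆ univ ×ˢ Ioi 0) :
    ∫ t in Ioi (0 : ℝ), ∫ x : ℝ,
      ((r₀ (x, t) + {p : ℝ × ℝ | ψ p.1 < p.2}.indicator r₁ (x, t)) * fderiv ℝ ζ (x, t) (0, 1)
      + (f₀ (x, t) + {p : ℝ × ℝ | ψ p.1 < p.2}.indicator f₁ (x, t)) * fderiv ℝ ζ (x, t) (1, 0))
    = (∫ x, (deriv ψ x * f₁ (x, ψ x) - r₁ (x, ψ x)) * ζ (x, ψ x))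
      - ∫ p, ζ p * (fderiv ℝ r₀ p (0, 1) + fderiv ℝ f₀ p (1, 0)
          + {p : ℝ × ℝ | ψ p.1 < p.2}.indicator
              (fun p => fderiv ℝ r₁ p (0, 1) + fderiv ℝ f₁ p (1, 0)) p) := by
  have hU : IsOpen ((univ : Set ℝ) ×ˢ Ioi (0 : ℝ)) := isOpen_univ.prod isOpen_Ioi
  have hψc := hψ.continuous
  set S := {p : ℝ × ℝ | ψ p.1 < p.2} with hS
  have hSm : MeasurableSet S :=
    (isOpen_lt (hψc.comp continuous_fst) continuous_snd).measurableSet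
  have hz : ∀ p : ℝ × ℝ, p.2 ≤ 0 → p ∉ tsupport ζ := fun p hp h => (hs h).2.not_ge hp
  have hz0 : ∀ p : ℝ × ℝ, p.2 ≤ 0 → ζ p = 0 := fun p hp =>
    image_eq_zero_of_notMem_tsupport (hz p hp)
  have hz1 : ∀ p : ℝ × ℝ, p.2 ≤ 0 → fderiv ℝ ζ p = 0 := fun p hp =>
    image_eq_zero_of_notMem_tsupport fun h => hz p hp (tsupport_fderiv_subset ℝ h)
  have B₀ := integral_epigraph_by_parts (ψ := fun _ => 0) hU hr₀ hf₀ contDiff_const hζ hζc hs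
  have B₁ := integral_epigraph_by_parts hU hr₁ hf₁ hψ hζ hζc hs
  simp only [hz0 (_, 0) le_rfl, mul_zero, integral_zero, zero_sub] at B₀
  rw [setIntegral_eq_integral_of_forall_compl_eq_zero
    (fun p hp => by simp [hz1 p (not_lt.1 hp)]),
    setIntegral_eq_integral_of_forall_compl_eq_zero
    (fun p hp => by simp [hz0 p (not_lt.1 hp)])] at B₀
  rw [← integral_indicator hSm, ← integral_indicator hSm] at B₁
  have i₀ := (integrable_mul_fderiv hU hr₀.continuousOn hζ hζc hs (0, 1)).add
    (integrable_mul_fderiv hU hf₀.continuousOn hζ hζc hs (1, 0))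
  have i₁ := ((integrable_mul_fderiv hU hr₁.continuousOn hζ hζc hs (0, 1)).add
    (integrable_mul_fderiv hU hf₁.continuousOn hζ hζc hs (1, 0))).indicator hSm
  have j₀ := (integrable_fderiv_mul hU hr₀ hζ.continuous hζc hs (0, 1)).add
    (integrable_fderiv_mul hU hf₀ hζ.continuous hζc hs (1, 0))
  have j₁ := ((integrable_fderiv_mul hU hr₁ hζ.continuous hζc hs (0, 1)).add
    (integrable_fderiv_mul hU hf₁ hζ.continuous hζc hs (1, 0))).indicator hSm
  have hleft := integral_add i₀ i₁
  have hright := integral_add j₀ j₁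
  rw [setIntegral_eq_integral_of_forall_compl_eq_zero
    (fun t ht => integral_eq_zero_of_ae (Filter.Eventually.of_forall fun x => by
      simp [hz1 (x, t) (not_lt.1 ht)]))]
  have hprod := integral_prod_symm _ (i₀.add i₁)
  have e₁ : ∀ x t, (r₀ (x, t) + S.indicator r₁ (x, t)) * fderiv ℝ ζ (x, t) (0, 1)
      + (f₀ (x, t) + S.indicator f₁ (x, t)) * fderiv ℝ ζ (x, t) (1, 0)
      = r₀ (x, t) * fderiv ℝ ζ (x, t) (0, 1) + f₀ (x, t) * fderiv ℝ ζ (x, t) (1, 0)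
        + S.indicator (fun p => r₁ p * fderiv ℝ ζ p (0, 1) + f₁ p * fderiv ℝ ζ p (1, 0)) (x, t) := by
    intro x t
    by_cases h : (x, t) ∈ S 
    · simp [h]
      ring
    · simp [h]
  have e₂ : ∀ p, ζ p * (fderiv ℝ r₀ p (0, 1) + fderiv ℝ f₀ p (1, 0)
          + S.indicator (fun p => fderiv ℝ r₁ p (0, 1) + fderiv ℝ f₁ p (1, 0)) p)
      = fderiv ℝ r₀ p (0, 1) * ζ p + fderiv ℝ f₀ p (1, 0) * ζ p
        + S.indicator (fun p => fderiv ℝ r₁ p (0, 1) * ζ p + fderiv ℝ f₁ p (1, 0) * ζ p) p := by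
    intro p
    by_cases h : p ∈ S 
    · simp [h]
      ring
    · simp [h]
      ring
  simp only [add_mul] at B₀ B₁
  simp only [e₁, e₂]
  refine hprod.symm.trans ?_
  refine hleft.trans ?_
  have hright' := congrArg
    (fun z => (∫ x, (deriv ψ x * f₁ (x, ψ x) - r₁ (x, ψ x)) * ζ (x, ψ x)) - z) hright
  refine Eq.trans ?_ hright'.symm
  have hB₀ : ∫ p, _ = _ := B₀
  have hB₁ : ∫ p, _ = _ := B₁
  refine (congrArg₂ (· + ·) hB₀ hB₁).trans ?_
  simp only [Pi.add_def]
  ring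

/-- For `ψ ∈ C²(ℝ)` with `ψ > 0`, `ψ' > 0`, `e ∈ C¹_c(ℝ)`, and
`R₀, R₁, u₀, u₁ ∈ C¹(ℝ × [0,∞))`, set `R = R₀ + H(t − ψ(x)) R₁` and
`u = u₀ + H(t − ψ(x)) u₁` with `H` the Heaviside function.  The δ-shock integral identity
(1) `∫₀^∞∫_ℝ (R ζ_t + u R ζ_x) dx dt + ∫_ℝ ((e/ψ') ζ_x(x,ψ(x)) + e ζ_t(x,ψ(x))) dx = 0`
for all smooth compactly supported test functions `ζ` on `ℝ × (0,∞)` is equivalent to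
(2): (i) the classical continuity equations `∂R₀/∂t + ∂(u₀R₀)/∂x = 0` for `0 < t < ψ(x)` and
`∂(R₀+R₁)/∂t + ∂((u₀+u₁)(R₀+R₁))/∂x = 0` for `t > ψ(x)`, together with
(ii) the Rankine–Hugoniot-type relation
`d/dx (e/ψ') = ψ'·[(u₀+u₁)(R₀+R₁) − u₀R₀](x,ψ(x)) − R₁(x,ψ(x))` for all `x`. -/
theorem delta_shock_integral_identity_iff_rankine_hugoniot
    (ψ : ℝ → ℝ) (hψ : ContDiff ℝ 2 ψ)
    (hψpos : ∀ x : ℝ, 0 < ψ x) (hψ'pos : ∀ x : ℝ, 0 < deriv ψ x)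
    (e : ℝ → ℝ) (he : ContDiff ℝ 1 e) (hesupp : HasCompactSupport e)
    (R₀ R₁ u₀ u₁ : ℝ → ℝ → ℝ)
    (hR₀ : ContDiffOn ℝ 1 (fun p : ℝ × ℝ => R₀ p.1 p.2) (univ ×ˢ Ici (0:ℝ)))
    (hR₁ : ContDiffOn ℝ 1 (fun p : ℝ × ℝ => R₁ p.1 p.2) (univ ×ˢ Ici (0:ℝ)))
    (hu₀ : ContDiffOn ℝ 1 (fun p : ℝ × ℝ => u₀ p.1 p.2) (univ ×ˢ Ici (0:ℝ)))
    (hu₁ : ContDiffOn ℝ 1 (fun p : ℝ × ℝ => u₁ p.1 p.2) (univ ×ˢ Ici (0:ℝ)))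
    (R u : ℝ → ℝ → ℝ)
    (hRdef : ∀ x t : ℝ, R x t = R₀ x t + (if ψ x < t then 1 else 0) * R₁ x t)
    (hudef : ∀ x t : ℝ, u x t = u₀ x t + (if ψ x < t then 1 else 0) * u₁ x t) :
    -- (1) the integral identity for all test functions on ℝ × (0,∞)
    (∀ ζ : ℝ → ℝ → ℝ,
        ContDiff ℝ (⊤ : ℕ∞) (fun p : ℝ × ℝ => ζ p.1 p.2) →
        HasCompactSupport (fun p : ℝ × ℝ => ζ p.1 p.2) →
        tsupport (fun p : ℝ × ℝ => ζ p.1 p.2) ⊆ univ ×ˢ Ioi (0:ℝ) →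
      (∫ t in Ioi (0:ℝ), ∫ x : ℝ,
          (R x t * deriv (fun s => ζ x s) t
            + u x t * R x t * deriv (fun y => ζ y t) x))
        + ∫ x : ℝ,
            (e x / deriv ψ x * deriv (fun y => ζ y (ψ x)) x
              + e x * deriv (fun s => ζ x s) (ψ x)) = 0)
    ↔
    -- (2)(i) classical continuity equations off the jump curve
    ((∀ x t : ℝ, 0 < t → t < ψ x →
        deriv (fun s => R₀ x s) t + deriv (fun y => u₀ y t * R₀ y t) x = 0) ∧
     (∀ x t : ℝ, ψ x < t →
        deriv (fun s => R₀ x s + R₁ x s) t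
          + deriv (fun y => (u₀ y t + u₁ y t) * (R₀ y t + R₁ y t)) x = 0) ∧
    -- (2)(ii) the Rankine–Hugoniot-type relation on the jump curve
     (∀ x : ℝ,
        deriv (fun y => e y / deriv ψ y) x
          = deriv ψ x *
              ((u₀ x (ψ x) + u₁ x (ψ x)) * (R₀ x (ψ x) + R₁ x (ψ x))
                - u₀ x (ψ x) * R₀ x (ψ x))
            - R₁ x (ψ x))) := by
  have hU : IsOpen ((univ : Set ℝ) ×ˢ Ioi (0 : ℝ)) := isOpen_univ.prod isOpen_Ioi
  have hsub : (univ : Set ℝ) ×ˢ Ioi (0 : ℝ) ⊆ univ ×ˢ Ici 0 := prod_mono_right Ioi_subset_Ici_self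
  set r₀ : ℝ × ℝ → ℝ := fun p => R₀ p.1 p.2
  set r₁ : ℝ × ℝ → ℝ := fun p => R₁ p.1 p.2
  set f₀ : ℝ × ℝ → ℝ := fun p => u₀ p.1 p.2 * R₀ p.1 p.2
  set f : ℝ × ℝ → ℝ := fun p => (u₀ p.1 p.2 + u₁ p.1 p.2) * (R₀ p.1 p.2 + R₁ p.1 p.2)
  set f₁ : ℝ × ℝ → ℝ := fun p => f p - f₀ p
  have cr₀ : ContDiffOn ℝ 1 r₀ (univ ×ˢ Ioi 0) := hR₀.mono hsub
  have cr₁ : ContDiffOn ℝ 1 r₁ (univ ×ˢ Ioi 0) := hR₁.mono hsub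
  have cf₀ : ContDiffOn ℝ 1 f₀ (univ ×ˢ Ioi 0) := (hu₀.mono hsub).mul cr₀
  have cf : ContDiffOn ℝ 1 f (univ ×ˢ Ioi 0) :=
    ((hu₀.mono hsub).add (hu₁.mono hsub)).mul (cr₀.add cr₁)
  have cf₁ : ContDiffOn ℝ 1 f₁ (univ ×ˢ Ioi 0) := cf.sub cf₀
  have hψ1 : ContDiff ℝ 1 ψ := hψ.of_le (by norm_num)
  have hψc := hψ1.continuous
  have cg : ContDiff ℝ 1 fun y => e y / deriv ψ y :=
    he.div ((contDiff_succ_iff_deriv (n := 1)).1 (by norm_num; exact hψ)).2.2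
      fun x => (hψ'pos x).ne'
  set g : ℝ → ℝ := fun y => e y / deriv ψ y with hg
  set S := {p : ℝ × ℝ | ψ p.1 < p.2} with hS
  have hSo : IsOpen S := isOpen_lt (hψc.comp continuous_fst) continuous_snd
  have hSU : S ⊆ univ ×ˢ Ioi 0 := fun p hp => ⟨trivial, (hψpos p.1).trans hp⟩
  set D₀ : ℝ × ℝ → ℝ := fun p => fderiv ℝ r₀ p (0, 1) + fderiv ℝ f₀ p (1, 0) with hD₀
  set D₁ : ℝ × ℝ → ℝ := fun p => fderiv ℝ r₁ p (0, 1) + fderiv ℝ f₁ p (1, 0) with hD₁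
  have cD₀ : ContinuousOn D₀ (univ ×ˢ Ioi 0) :=
    (continuousOn_fderiv_apply hU cr₀ _).add (continuousOn_fderiv_apply hU cf₀ _)
  have cD₁ : ContinuousOn D₁ (univ ×ˢ Ioi 0) :=
    (continuousOn_fderiv_apply hU cr₁ _).add (continuousOn_fderiv_apply hU cf₁ _)
  have dAt : ∀ {F : ℝ × ℝ → ℝ}, ContDiffOn ℝ 1 F (univ ×ˢ Ioi 0) → ∀ {x t : ℝ}, 0 < t →
      DifferentiableAt ℝ F (x, t) := fun hF x t ht =>
    (hF.differentiableOn one_ne_zero).differentiableAt (hU.mem_nhds ⟨trivial, ht⟩)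
  have eD₀ : ∀ x t : ℝ, 0 < t →
      deriv (fun s => R₀ x s) t + deriv (fun y => u₀ y t * R₀ y t) x = D₀ (x, t) :=
    fun x t ht => congrArg₂ (· + ·) (hasDerivAt_vertical (dAt cr₀ ht)).deriv
      (hasDerivAt_horizontal (dAt cf₀ ht)).deriv
  have eD₁ : ∀ x t : ℝ, 0 < t →
      deriv (fun s => R₀ x s + R₁ x s) t
        + deriv (fun y => (u₀ y t + u₁ y t) * (R₀ y t + R₁ y t)) x = D₀ (x, t) + D₁ (x, t) := by
    intro x t ht
    have h1 : deriv (fun s => R₀ x s + R₁ x s) t = _ :=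
      ((hasDerivAt_vertical (dAt cr₀ ht)).add (hasDerivAt_vertical (dAt cr₁ ht))).deriv
    have h2 : deriv (fun y => (u₀ y t + u₁ y t) * (R₀ y t + R₁ y t)) x = _ :=
      (hasDerivAt_horizontal (dAt cf ht)).deriv
    have h3 : fderiv ℝ f₁ (x, t) = fderiv ℝ f (x, t) - fderiv ℝ f₀ (x, t) :=
      fderiv_fun_sub (dAt cf ht) (dAt cf₀ ht)
    rw [h1, h2]
    simp only [hD₀, hD₁, h3, sub_apply]
    ring
  set J : ℝ → ℝ := fun x => deriv ψ x * f₁ (x, ψ x) - r₁ (x, ψ x) - deriv g x with hJ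
  have graphU : ∀ x, (x, ψ x) ∈ (univ : Set ℝ) ×ˢ Ioi (0 : ℝ) := fun x => ⟨trivial, hψpos x⟩
  have cgraph : ∀ {F : ℝ × ℝ → ℝ}, ContDiffOn ℝ 1 F (univ ×ˢ Ioi 0) →
      Continuous fun x => F (x, ψ x) := fun hF =>
    hF.continuousOn.comp_continuous (by fun_prop) graphU
  have cK : Continuous fun x => deriv ψ x * f₁ (x, ψ x) - r₁ (x, ψ x) :=
    ((hψ1.continuous_deriv le_rfl).mul (cgraph cf₁)).sub (cgraph cr₁)
  have cg' : Continuous (deriv g) := cg.continuous_deriv le_rfl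
  have cJ : Continuous J := cK.sub cg'
  have master : ∀ ζ : ℝ × ℝ → ℝ, ContDiff ℝ (⊤ : ℕ∞) ζ → HasCompactSupport ζ →
      tsupport ζ ⊆ univ ×ˢ Ioi (0 : ℝ) →
      (∫ t in Ioi (0 : ℝ), ∫ x : ℝ,
          (R x t * deriv (fun s => ζ (x, s)) t + u x t * R x t * deriv (fun y => ζ (y, t)) x))
        + ∫ x : ℝ, (e x / deriv ψ x * deriv (fun y => ζ (y, ψ x)) x
              + e x * deriv (fun s => ζ (x, s)) (ψ x))
      = (∫ x, J x * ζ (x, ψ x)) - ∫ p, ζ p * (D₀ p + S.indicator D₁ p) := by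
    intro ζ hζ hζc hs
    have hζ1 : ContDiff ℝ 1 ζ := hζ.of_le (by exact_mod_cast le_top)
    have dζ : Differentiable ℝ ζ := hζ1.differentiable one_ne_zero
    have sζ := hζc.comp_graph hψc
    have hζ0 : Continuous fun x => ζ (x, ψ x) := hζ1.continuous.comp (by fun_prop)
    have h1 := integral_jump_by_parts cr₀ cf₀ cr₁ cf₁ hψ1 hζ1 hζc hs
    have h2 := integral_mul_deriv_along_graph cg hψ1 hζ1 hζc
    have h3 : ∫ x, J x * ζ (x, ψ x)
        = (∫ x, (deriv ψ x * f₁ (x, ψ x) - r₁ (x, ψ x)) * ζ (x, ψ x))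
          - ∫ x, deriv g x * ζ (x, ψ x) := by
      refine Eq.trans ?_ (integral_sub ((cK.mul hζ0).integrable_of_hasCompactSupport sζ.mul_left)
        ((cg'.mul hζ0).integrable_of_hasCompactSupport sζ.mul_left))
      congr 1 with x
      simp only [hJ]
      ring
    simp only [(hasDerivAt_vertical (dζ _)).deriv, (hasDerivAt_horizontal (dζ _)).deriv]
    have e1 : ∀ x t : ℝ, R x t * fderiv ℝ ζ (x, t) (0, 1) + u x t * R x t * fderiv ℝ ζ (x, t) (1, 0)
        = (r₀ (x, t) + S.indicator r₁ (x, t)) * fderiv ℝ ζ (x, t) (0, 1)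
          + (f₀ (x, t) + S.indicator f₁ (x, t)) * fderiv ℝ ζ (x, t) (1, 0) := by
      intro x t
      by_cases h : ψ x < t <;> simp [hRdef, hudef, indicator, hS, h, r₀, r₁, f₀, f₁, f]
    have e2 : ∀ x : ℝ, e x / deriv ψ x * fderiv ℝ ζ (x, ψ x) (1, 0)
        + e x * fderiv ℝ ζ (x, ψ x) (0, 1)
        = g x * (fderiv ℝ ζ (x, ψ x) (1, 0) + deriv ψ x * fderiv ℝ ζ (x, ψ x) (0, 1)) := by
      intro x
      have := (hψ'pos x).ne'
      simp only [hg]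
      field_simp
    simp only [e1, e2]
    rw [h1, h2, h3]
    ring
  have bulk : (∀ x t : ℝ, 0 < t → t < ψ x → D₀ (x, t) = 0) →
      (∀ x t : ℝ, ψ x < t → D₀ (x, t) + D₁ (x, t) = 0) → ∀ ζ : ℝ × ℝ → ℝ,
      tsupport ζ ⊆ univ ×ˢ Ioi (0 : ℝ) → ∫ p, ζ p * (D₀ p + S.indicator D₁ p) = 0 := by
    intro below above ζ hs
    refine integral_eq_zero_of_ae (Filter.Eventually.of_forall fun p => ?_)
    obtain ⟨x, t⟩ := p
    change ζ (x, t) * (D₀ (x, t) + S.indicator D₁ (x, t)) = 0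
    by_cases hp : (x, t) ∈ S
    · simp [hp, above x t hp]
    rcases le_or_gt t 0 with ht | ht
    · rw [image_eq_zero_of_notMem_tsupport fun h => (hs h).2.not_ge ht, zero_mul]
    suffices D₀ (x, t) = 0 by simp [hp, this]
    rcases (not_lt.1 hp : t ≤ ψ x).lt_or_eq with h | h
    · exact below x t ht h
    have hc : ContinuousAt (fun s => D₀ (x, s)) t :=
      (cD₀.continuousAt (x := (x, t)) (hU.mem_nhds ⟨trivial, ht⟩)).comp
        (f := fun s => (x, s)) (by fun_prop)
    have hl : (fun s => D₀ (x, s)) =ᶠ[nhdsWithin t (Iio t)] fun _ => 0 := by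
      filter_upwards [Ioo_mem_nhdsLT ht] with s hs
      exact below x s hs.1 (hs.2.trans_eq h)
    exact tendsto_nhds_unique (hc.tendsto.mono_left nhdsWithin_le_nhds)
      (tendsto_const_nhds.congr' hl.symm)
  constructor
  · intro h
    have h' : ∀ ζ : ℝ × ℝ → ℝ, ContDiff ℝ (⊤ : ℕ∞) ζ → HasCompactSupport ζ →
        tsupport ζ ⊆ univ ×ˢ Ioi (0 : ℝ) →
        (∫ x, J x * ζ (x, ψ x)) - ∫ p, ζ p * (D₀ p + S.indicator D₁ p) = 0 :=
      fun ζ h1 h2 h3 => (master ζ h1 h2 h3).symm.trans (h (fun x t => ζ (x, t)) h1 h2 h3)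
    have below : ∀ x t : ℝ, 0 < t → t < ψ x → D₀ (x, t) = 0 := by
      intro x t ht htψ
      have hV : IsOpen ((univ : Set ℝ) ×ˢ Ioi (0 : ℝ) ∩ {p | p.2 < ψ p.1}) :=
        hU.inter (isOpen_lt continuous_snd (hψc.comp continuous_fst))
      refine (cD₀.mono inter_subset_left).eq_zero_of_integral_test_mul_eq_zero
        (μ := volume) hV (fun ζ h1 h2 h3 => ?_) ⟨⟨trivial, ht⟩, htψ⟩
      have hz : ∀ p : ℝ × ℝ, ψ p.1 ≤ p.2 → ζ p = 0 := fun p hp =>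
        image_eq_zero_of_notMem_tsupport fun hm => (h3 hm).2.not_ge hp
      have := h' ζ h1 h2 (h3.trans inter_subset_left)
      simp only [hz (_, ψ _) le_rfl, mul_zero, integral_zero, zero_sub, neg_eq_zero] at this
      rw [← this]
      congr 1 with p
      by_cases hp : p ∈ S
      · simp [hz p (le_of_lt hp)]
      · simp [hp]
    have above : ∀ x t : ℝ, ψ x < t → D₀ (x, t) + D₁ (x, t) = 0 := by
      intro x t htψ
      refine ((cD₀.add cD₁).mono hSU).eq_zero_of_integral_test_mul_eq_zero
        (μ := volume) hSo (fun ζ h1 h2 h3 => ?_) (x := (x, t)) htψ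
      have hz : ∀ p : ℝ × ℝ, p.2 ≤ ψ p.1 → ζ p = 0 := fun p hp =>
        image_eq_zero_of_notMem_tsupport fun hm => (show ψ p.1 < p.2 from h3 hm).not_ge hp
      have := h' ζ h1 h2 (h3.trans hSU)
      simp only [hz (_, ψ _) le_rfl, mul_zero, integral_zero, zero_sub, neg_eq_zero] at this
      rw [← this]
      congr 1 with p
      by_cases hp : p ∈ S
      · simp [hp]
      · simp [hz p (not_lt.1 hp)]
    refine ⟨fun x t ht htψ => (eD₀ x t ht).trans (below x t ht htψ),
      fun x t htψ => (eD₁ x t ((hψpos x).trans htψ)).trans (above x t htψ), fun x => ?_⟩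
    have hx := hψpos x
    let χ : ContDiffBump (ψ x) := ⟨ψ x / 4, ψ x / 2, by linarith, by linarith⟩
    have hχ : ∀ t ∉ Metric.closedBall (ψ x) (ψ x / 2), χ t = 0 := fun t ht =>
      χ.zero_of_le_dist (not_le.1 ht).le
    have hJx : J x * χ (ψ x) = 0 := by
      refine ContinuousOn.eq_zero_of_integral_test_mul_eq_zero (μ := volume) (U := univ)
        (f := fun y => J y * χ (ψ y)) (cJ.mul (χ.continuous.comp hψc)).continuousOn isOpen_univ
        (fun η h1 h2 _ => ?_) trivial
      have hs : tsupport (fun p : ℝ × ℝ => η p.1 * χ p.2) ⊆ univ ×ˢ Ioi (0 : ℝ) := by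
        refine (closure_minimal (t := univ ×ˢ Metric.closedBall (ψ x) (ψ x / 2)) ?_
          (isClosed_univ.prod Metric.isClosed_closedBall)).trans ?_
        · intro p hp
          refine ⟨trivial, by_contra fun h => hp ?_⟩
          simp [hχ p.2 h]
        · refine prod_mono_right fun t ht => ?_
          rw [Real.closedBall_eq_Icc] at ht
          exact lt_of_lt_of_le (by linarith) ht.1
      have hc : HasCompactSupport (fun p : ℝ × ℝ => η p.1 * χ p.2) := by
        refine HasCompactSupport.intro (h2.isCompact.prod
          (isCompact_closedBall (ψ x) (ψ x / 2))) fun p hp => ?_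
        by_cases h : p.1 ∈ tsupport η
        · simp [hχ p.2 fun h' => hp ⟨h, h'⟩]
        · simp [image_eq_zero_of_notMem_tsupport h]
      have := h' (fun p => η p.1 * χ p.2) ((h1.comp contDiff_fst).mul (χ.contDiff.comp contDiff_snd)) hc hs
      rw [bulk below above _ hs, sub_zero] at this
      rw [← this]
      congr 1 with y
      ring
    rw [χ.one_of_mem_closedBall (Metric.mem_closedBall_self χ.rIn_pos.le), mul_one] at hJx
    exact (sub_eq_zero.1 hJx).symm
  · rintro ⟨below, above, jump⟩ ζ h1 h2 h3
    refine (master (fun p => ζ p.1 p.2) h1 h2 h3).trans ?_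
    have hJ0 : ∀ x, J x = 0 := fun x => sub_eq_zero.2 (jump x).symm
    rw [bulk (fun x t ht htψ => (eD₀ x t ht).symm.trans (below x t ht htψ))
      (fun x t htψ => (eD₁ x t ((hψpos x).trans htψ)).symm.trans (above x t htψ)) _ h3]
    simp [hJ0]
end
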